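/- Define vector fields V₁, V₂, V₃ : ℝ¹⁰ → ℝ¹⁰, writing coordinates on ℝ¹⁰ as (a₁,a₂,a₃,a₄,α₁,α₂,α₃,β₁,β₂,γ), by: V₁ = −α₁ ∂_{a₂} − α₂ ∂_{a₃} + 3α₃ ∂_{a₄} − 2β₁ ∂_{α₂} + 2β₂ ∂_{α₃} − γ ∂_{β₂}; V₂ = 3α₁ ∂_{a₁} + α₂ ∂_{a₂} − α₃ ∂_{a₃} + 2β₁ ∂_{α₁} + 2β₂ ∂_{α₂} + γ ∂_{β₁}; V₃ = 3a₂ ∂_{a₁} + (2a₃ − a₁) ∂_{a₂} + (a₄ − 2a₂) ∂_{a₃} − 3a₃ ∂_{a₄} + α₂ ∂_{α₁} − 2(α₁ + α₃) ∂_{α₂} + α₂ ∂_{α₃} + β₂ ∂_{β₁} − β₁ ∂_{β₂}. Then, with the Lie bracket of vector fields [V,W](x) = (DW)(x)(V(x)) − (DV)(x)(W(x)), one has [V₁,V₂] = 0, [V₁,V₃] = −V₂, and [V₂,V₃] = V₁. Consequently V₁, V₂, V₃ span a Lie algebra isomorphic to the Lie algebra of Killing vector fields of the Euclidean plane, whose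 generators X = ∂_x, Y = ∂_y, R = y∂_x − x∂_y satisfy [X,Y] = 0, [X,R] = −Y, [Y,R] = X. -/

import Mathlib

/- STATEMENT 7: The vector fields V₁, V₂, V₃ on the parameter space ℝ¹⁰ of valence-three
Killing tensors satisfy [V₁,V₂] = 0, [V₁,V₃] = −V₂, [V₂,V₃] = V₁, i.e. the same
commutator relations as the generators X = ∂ₓ, Y = ∂_y, R = y∂ₓ − x∂_y of the Lie
algebra of Killing vector fields of the Euclidean plane. -/

noncomputable section

/-- Lie bracket of vector fields: [V,W](x) = DW(x)(V(x)) − DV(x)(W(x)). -/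
def lieBracket {E : Type*} [NormedAddCommGroup E] [NormedSpace ℝ E]
    (V W : E → E) : E → E :=
  fun x => fderiv ℝ W x (V x) - fderiv ℝ V x (W x)

/- Coordinates on ℝ¹⁰ = Fin 10 → ℝ:
0:a₁, 1:a₂, 2:a₃, 3:a₄, 4:α₁, 5:α₂, 6:α₃, 7:β₁, 8:β₂, 9:γ. -/

def V₁ : (Fin 10 → ℝ) → (Fin 10 → ℝ) :=
  fun x => ![0, -x 4, -x 5, 3 * x 6, 0, -2 * x 7, 2 * x 8, 0, -x 9, 0]

def V₂ : (Fin 10 → ℝ) → (Fin 10 → ℝ) :=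
  fun x => ![3 * x 4, x 5, -x 6, 0, 2 * x 7, 2 * x 8, 0, x 9, 0, 0]

def V₃ : (Fin 10 → ℝ) → (Fin 10 → ℝ) :=
  fun x => ![3 * x 1, 2 * x 2 - x 0, x 3 - 2 * x 1, -3 * x 2,
             x 5, -2 * (x 4 + x 6), x 5, x 8, -x 7, 0]

/-- X = ∂ₓ on the Euclidean plane. -/
def X : ℝ × ℝ → ℝ × ℝ := fun _ => (1, 0)

/-- Y = ∂_y on the Euclidean plane. -/
def Y : ℝ × ℝ → ℝ × ℝ := fun _ => (0, 1)

/-- R = y∂ₓ − x∂_y on the Euclidean plane. -/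
def R : ℝ × ℝ → ℝ × ℝ := fun p => (p.2, -p.1)

/-- A linear map on a finite-dimensional real space is its own derivative at every point. -/
theorem IsLinearMap.fderiv_apply {E F : Type*} [NormedAddCommGroup E] [NormedSpace ℝ E]
    [FiniteDimensional ℝ E] [NormedAddCommGroup F] [NormedSpace ℝ F] {f : E → F}
    (hf : IsLinearMap ℝ f) (x v : E) : fderiv ℝ f x v = f v := by
  have h : f = (hf.mk' f).toContinuousLinearMap := rfl
  rw [h, ContinuousLinearMap.fderiv]

theorem isLinearMap_V₁ : IsLinearMap ℝ V₁ := by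
  constructor <;> intros <;> ext i <;> fin_cases i <;> simp [V₁] <;> ring

theorem isLinearMap_V₂ : IsLinearMap ℝ V₂ := by
  constructor <;> intros <;> ext i <;> fin_cases i <;> simp [V₂] <;> ring

theorem isLinearMap_V₃ : IsLinearMap ℝ V₃ := by
  constructor <;> intros <;> ext i <;> fin_cases i <;> simp [V₃] <;> ring

theorem isLinearMap_R : IsLinearMap ℝ R := by
  constructor <;> intros <;> ext <;> simp [R]; ring

theorem fderiv_X (p : ℝ × ℝ) : fderiv ℝ X p = 0 :=
  fderiv_const_apply _

theorem fderiv_Y (p : ℝ × ℝ) : fderiv ℝ Y p = 0 :=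
  fderiv_const_apply _

theorem induced_action_isomorphic_to_euclidean_isometry_algebra :
    (∀ x : Fin 10 → ℝ, lieBracket V₁ V₂ x = 0) ∧
    (∀ x : Fin 10 → ℝ, lieBracket V₁ V₃ x = -V₂ x) ∧
    (∀ x : Fin 10 → ℝ, lieBracket V₂ V₃ x = V₁ x) ∧
    (∀ p : ℝ × ℝ, lieBracket X Y p = 0) ∧
    (∀ p : ℝ × ℝ, lieBracket X R p = -Y p) ∧
    (∀ p : ℝ × ℝ, lieBracket Y R p = X p) := by
  refine ⟨fun x => ?_, fun x => ?_, fun x => ?_, fun p => ?_, fun p => ?_, fun p => ?_⟩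
  · rw [lieBracket, isLinearMap_V₁.fderiv_apply, isLinearMap_V₂.fderiv_apply]
    ext i; fin_cases i <;> simp [V₁, V₂]
  · rw [lieBracket, isLinearMap_V₁.fderiv_apply, isLinearMap_V₃.fderiv_apply]
    ext i; fin_cases i <;> simp [V₁, V₂, V₃] <;> ring
  · rw [lieBracket, isLinearMap_V₂.fderiv_apply, isLinearMap_V₃.fderiv_apply]
    ext i; fin_cases i <;> simp [V₁, V₂, V₃] <;> ring
  · simp [lieBracket, fderiv_X, fderiv_Y]
  · rw [lieBracket, isLinearMap_R.fderiv_apply, fderiv_X]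
    simp [X, Y, R]
  · rw [lieBracket, isLinearMap_R.fderiv_apply, fderiv_Y]
    simp [X, Y, R]
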